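/- For every anti-quasi-Sasakian manifold (M,φ,ξ,η,g), the 2-form 𝒜 defined by 𝒜(X,Y) = g(X,AY), where A = -φ∘∇ξ, is closed: d𝒜 = 0. -/

import Mathlib

/-!
We work in a Koszul-style algebraic framework for the calculus of vector fields on a
smooth manifold: `F` plays the role of the commutative ℝ-algebra of smooth functions
on the manifold `M`, and `V` plays the role of the `F`-module of smooth vector fields.
`act` is the action of vector fields on functions (as ℝ-derivations) and `lie` is the
Lie bracket of vector fields.  All the classical tensors (differentials of forms via the
global Koszul formulas, the Nijenhuis torsion, Lie derivatives, Levi-Civita connection,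
curvature, ...) are expressed through their standard global formulas in this framework.
-/

structure VFCalc (F : Type) (V : Type) [CommRing F] [Algebra ℝ F]
    [AddCommGroup V] [Module F V] where
  /-- action of a vector field on a function, `X f` -/
  act : V → F → F
  /-- Lie bracket of vector fields -/
  lie : V → V → V
  act_addV : ∀ X Y f, act (X + Y) f = act X f + act Y f
  act_smulV : ∀ (h : F) (X : V) (f : F), act (h • X) f = h * act X f
  act_add : ∀ X f g, act X (f + g) = act X f + act X g
  act_mul : ∀ X f g, act X (f * g) = act X f * g + f * act X g
  act_algebraMap : ∀ X (r : ℝ), act X (algebraMap ℝ F r) = 0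
  lie_add_left : ∀ X Y Z, lie (X + Y) Z = lie X Z + lie Y Z
  lie_skew : ∀ X Y, lie X Y = -lie Y X
  lie_smul_right : ∀ (f : F) (X Y : V), lie X (f • Y) = act X f • Y + f • lie X Y
  lie_jacobi : ∀ X Y Z, lie X (lie Y Z) + lie Y (lie Z X) + lie Z (lie X Y) = 0
  act_lie : ∀ X Y f, act (lie X Y) f = act X (act Y f) - act Y (act X f)

namespace VFCalc

variable {F V : Type} [CommRing F] [Algebra ℝ F] [AddCommGroup V] [Module F V]
variable (C : VFCalc F V)

/-- Exterior differential of a 1-form, `dη(X,Y) = X(η(Y)) - Y(η(X)) - η([X,Y])`. -/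
def d1 (η : V → F) (X Y : V) : F := C.act X (η Y) - C.act Y (η X) - η (C.lie X Y)

/-- Exterior differential of a 2-form (Koszul global formula). -/
def d2 (ω : V → V → F) (X Y Z : V) : F :=
  C.act X (ω Y Z) - C.act Y (ω X Z) + C.act Z (ω X Y)
    - ω (C.lie X Y) Z + ω (C.lie X Z) Y - ω (C.lie Y Z) X

/-- The tensor `N_φ = [φ,φ] + dη ⊗ ξ` of an almost contact structure. -/
def nij (φ : V → V) (ξ : V) (η : V → F) (X Y : V) : V :=
  C.lie (φ X) (φ Y) + φ (φ (C.lie X Y)) - φ (C.lie X (φ Y)) - φ (C.lie (φ X) Y)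
    + C.d1 η X Y • ξ

/-- `ξ` is a Killing vector field for `g`, i.e. `L_ξ g = 0`. -/
def IsKilling (g : V → V → F) (ξ : V) : Prop :=
  ∀ X Y, C.act ξ (g X Y) - g (C.lie ξ X) Y - g X (C.lie ξ Y) = 0

/-- Riemann curvature tensor `R(X,Y)Z = ∇_X ∇_Y Z - ∇_Y ∇_X Z - ∇_{[X,Y]} Z`. -/
def curv (D : V → V → V) (X Y Z : V) : V :=
  D X (D Y Z) - D Y (D X Z) - D (C.lie X Y) Z

end VFCalc

/-- An almost contact structure `(φ, ξ, η)` (without metric): `φ² = -I + η ⊗ ξ`, `η(ξ)=1`. -/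
structure IsACS {F V : Type} [CommRing F] [AddCommGroup V] [Module F V]
    (φ : V → V) (ξ : V) (η : V → F) : Prop where
  φ_add : ∀ X Y, φ (X + Y) = φ X + φ Y
  φ_smul : ∀ (f : F) (X : V), φ (f • X) = f • φ X
  η_add : ∀ X Y, η (X + Y) = η X + η Y
  η_smul : ∀ (f : F) (X : V), η (f • X) = f * η X
  φ_sq : ∀ X, φ (φ X) = -X + η X • ξ
  η_ξ : η ξ = 1

/-- An almost contact metric structure `(φ, ξ, η, g)`. -/
structure IsACMS {F V : Type} [CommRing F] [AddCommGroup V] [Module F V]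
    (φ : V → V) (ξ : V) (η : V → F) (g : V → V → F) : Prop where
  φ_add : ∀ X Y, φ (X + Y) = φ X + φ Y
  φ_smul : ∀ (f : F) (X : V), φ (f • X) = f • φ X
  η_add : ∀ X Y, η (X + Y) = η X + η Y
  η_smul : ∀ (f : F) (X : V), η (f • X) = f * η X
  g_add_left : ∀ X Y Z, g (X + Y) Z = g X Z + g Y Z
  g_smul_left : ∀ (f : F) (X Y : V), g (f • X) Y = f * g X Y
  g_symm : ∀ X Y, g X Y = g Y X
  φ_sq : ∀ X, φ (φ X) = -X + η X • ξ
  η_ξ : η ξ = 1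
  g_compat : ∀ X Y, g (φ X) (φ Y) = g X Y - η X * η Y

/-- The fundamental 2-form `Φ(X,Y) = g(X, φY)`. -/
def fund {F V : Type} [CommRing F] [AddCommGroup V] [Module F V]
    (g : V → V → F) (φ : V → V) (X Y : V) : F := g X (φ Y)

/-- The axioms of the Levi-Civita connection of `g` (which characterize it uniquely). -/
structure IsLeviCivita {F V : Type} [CommRing F] [Algebra ℝ F] [AddCommGroup V] [Module F V]
    (C : VFCalc F V) (g : V → V → F) (D : V → V → V) : Prop where
  add_left : ∀ X Y Z, D (X + Y) Z = D X Z + D Y Z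
  smul_left : ∀ (f : F) (X Y : V), D (f • X) Y = f • D X Y
  add_right : ∀ X Y Z, D X (Y + Z) = D X Y + D X Z
  leibniz : ∀ (f : F) (X Y : V), D X (f • Y) = C.act X f • Y + f • D X Y
  torsion_free : ∀ X Y, D X Y - D Y X = C.lie X Y
  metric : ∀ X Y Z, C.act X (g Y Z) = g (D X Y) Z + g Y (D X Z)

/-- Anti-normality: `N_φ = 2 dη ⊗ ξ`. -/
def AntiNormal {F V : Type} [CommRing F] [Algebra ℝ F] [AddCommGroup V] [Module F V]
    (C : VFCalc F V) (φ : V → V) (ξ : V) (η : V → F) : Prop :=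
  ∀ X Y, C.nij φ ξ η X Y = (2 * C.d1 η X Y) • ξ

/-- Anti-quasi-Sasakian: `dΦ = 0` and `N_φ = 2 dη ⊗ ξ`. -/
def IsAqS {F V : Type} [CommRing F] [Algebra ℝ F] [AddCommGroup V] [Module F V]
    (C : VFCalc F V) (φ : V → V) (ξ : V) (η : V → F) (g : V → V → F) : Prop :=
  (∀ X Y Z, C.d2 (fund g φ) X Y Z = 0) ∧ AntiNormal C φ ξ η

theorem two_cancel {F : Type} [CommRing F] [Algebra ℝ F] {x : F} (h : 2 * x = 0) : x = 0 := by
  have h1 : algebraMap ℝ F (1/2) * 2 = 1 := by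
    have : (2 : F) = algebraMap ℝ F 2 := (map_ofNat _ 2).symm
    rw [this, ← map_mul]; norm_num
  calc x = (algebraMap ℝ F (1/2) * 2) * x := by rw [h1, one_mul]
    _ = 0 := by rw [mul_assoc, h, mul_zero]

/-- Proposition `Prop:dA=0`.
For every anti-quasi-Sasakian manifold, the 2-form `𝒜(X,Y) = g(X, AY)`, with
`A = -φ ∘ ∇ξ`, is closed. -/
theorem statement12
    {F V : Type} [CommRing F] [Algebra ℝ F] [AddCommGroup V] [Module F V]
    (C : VFCalc F V) (φ : V → V) (ξ : V) (η : V → F) (g : V → V → F)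
    (hACMS : IsACMS φ ξ η g)
    (D : V → V → V) (hLC : IsLeviCivita C g D)
    (hAqS : IsAqS C φ ξ η g)
    (A : V → V) (hA : ∀ X, A X = -φ (D X ξ)) :
    ∀ X Y Z, C.d2 (fun X Y => g X (A Y)) X Y Z = 0 := by
  have aZ : ∀ X, C.act X 0 = 0 := fun X => by
    have := C.act_add X 0 0
    simpa using this
  have aN : ∀ X f, C.act X (-f) = -C.act X f := fun X f => by
    have := C.act_add X f (-f)
    rw [add_neg_cancel, aZ] at this
    linear_combination -this
  have aS : ∀ X f h, C.act X (f - h) = C.act X f - C.act X h := fun X f h => by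
    rw [sub_eq_add_neg, C.act_add, aN]; ring
  have a1 : ∀ X, C.act X 1 = 0 := fun X => by
    have := C.act_algebraMap X 1
    simpa using this
  have a2 : ∀ X f, C.act X (2 * f) = 2 * C.act X f := fun X f => by
    rw [two_mul, C.act_add]; ring
  have lAR : ∀ X Y Z, C.lie X (Y + Z) = C.lie X Y + C.lie X Z := fun X Y Z => by
    rw [C.lie_skew, C.lie_add_left, C.lie_skew X Y, C.lie_skew X Z]; abel
  have lSL : ∀ (f : F) X Y, C.lie (f • X) Y = -(C.act Y f • X) + f • C.lie X Y := fun f X Y => by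
    rw [C.lie_skew, C.lie_smul_right, C.lie_skew X Y, smul_neg]; abel
  have φZ : φ 0 = 0 := by simpa using hACMS.φ_add 0 0
  have φN : ∀ X, φ (-X) = -φ X := fun X => by
    have := hACMS.φ_add X (-X)
    rw [add_neg_cancel, φZ] at this
    exact (neg_eq_of_add_eq_zero_right this.symm).symm
  have ηZ : η 0 = 0 := by simpa using hACMS.η_add 0 0
  have ηN : ∀ X, η (-X) = -η X := fun X => by
    have := hACMS.η_add X (-X)
    rw [add_neg_cancel, ηZ] at this
    linear_combination -this
  have gZ : ∀ Y, g 0 Y = 0 := fun Y => by simpa using hACMS.g_add_left 0 0 Y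
  have gNL : ∀ X Y, g (-X) Y = -g X Y := fun X Y => by
    have := hACMS.g_add_left X (-X) Y
    rw [add_neg_cancel, gZ] at this
    linear_combination -this
  have gNR : ∀ X Y, g X (-Y) = -g X Y := fun X Y => by
    rw [hACMS.g_symm, gNL, hACMS.g_symm]
  have gAR : ∀ X Y Z, g X (Y + Z) = g X Y + g X Z := fun X Y Z => by
    rw [hACMS.g_symm, hACMS.g_add_left, hACMS.g_symm Y, hACMS.g_symm Z]
  have gSR : ∀ (f : F) X Y, g X (f • Y) = f * g X Y := fun f X Y => by
    rw [hACMS.g_symm, hACMS.g_smul_left, hACMS.g_symm Y]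
  -- the (nilpotent) defect f
  obtain ⟨f, hf⟩ : ∃ f, f = η (φ ξ) := ⟨_, rfl⟩
  have φφξ : φ (φ ξ) = 0 := by rw [hACMS.φ_sq, hACMS.η_ξ, one_smul]; abel
  have φξ : φ ξ = f • ξ := by
    have := hACMS.φ_sq (φ ξ)
    rw [φφξ, φZ, ← hf] at this
    rw [eq_comm, neg_add_eq_zero] at this
    exact this
  have ff : f * f = 0 := by
    have h := φφξ
    rw [φξ, hACMS.φ_smul, φξ, smul_smul] at h
    have := congrArg η h
    rw [hACMS.η_smul, ηZ, hACMS.η_ξ, mul_one] at this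
    exact this
  have ηφ : ∀ X, η (φ X) = f * η X := fun X => by
    have h := hACMS.φ_sq (φ X)
    rw [hACMS.φ_sq X, hACMS.φ_add, φN, hACMS.φ_smul, φξ] at h
    have h2 := congrArg η (add_left_cancel h)
    rw [hACMS.η_smul, hACMS.η_smul, hACMS.η_smul, hACMS.η_ξ] at h2
    linear_combination -h2
  have gξ : ∀ X, g X ξ = η X := fun X => by
    have h0 := hACMS.g_compat X ξ
    have h1 := hACMS.g_compat (φ X) ξ
    rw [φξ, gSR, hACMS.η_ξ] at h0 h1
    rw [ηφ] at h1
    linear_combination -h0 - f * h1 + (g (φ (φ X)) ξ + η X) * ff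
  have skew : ∀ X Y, g X (φ Y) = -g (φ X) Y + 2 * f * η X * η Y := fun X Y => by
    have h := hACMS.g_compat X (φ Y)
    rw [hACMS.φ_sq, gAR, gNR, gSR, gξ, ηφ, ηφ] at h
    linear_combination -h
  obtain ⟨hd, hN⟩ := hAqS
  -- f is constant and kills derivatives
  have af : ∀ Z, C.act Z f = 0 := fun Z => by
    have h := hd ξ ξ Z
    simp only [VFCalc.d2, fund] at h
    have h0 : C.lie ξ ξ = C.lie ξ ξ := rfl
    have hg : g ξ (φ ξ) = f := by rw [φξ, gSR, gξ, hACMS.η_ξ, mul_one]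
    have hl : g (C.lie ξ ξ) (φ Z) = 0 := by
      apply two_cancel
      have := congrArg (fun W => g W (φ Z)) (C.lie_skew ξ ξ)
      simp only [gNL] at this
      linear_combination this
    rw [hg, hl] at h
    linear_combination h
  have fa : ∀ Z h, f * C.act Z h = 0 := fun Z h => by
    have h1 := hd ξ (h • ξ) Z
    have h2 := hd ξ ξ Z
    simp only [VFCalc.d2, fund] at h1 h2
    simp only [C.lie_smul_right, lSL, hACMS.g_add_left, hACMS.g_smul_left, gNL, hACMS.φ_smul,
      gSR, C.act_mul, C.act_smulV, φξ, gξ, hACMS.η_ξ, hACMS.η_smul, C.act_add, hACMS.η_add, af, a1] at h1 h2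
    apply two_cancel
    linear_combination h1 - h * h2
  -- W = dη
  obtain ⟨W, hW⟩ : ∃ W : V → V → F, W = C.d1 η := ⟨_, rfl⟩
  have Wd : ∀ X Y, W X Y = C.act X (η Y) - C.act Y (η X) - η (C.lie X Y) := fun X Y => by
    rw [hW]; rfl
  have Wsk : ∀ X Y, W X Y = -W Y X := fun X Y => by
    rw [Wd, Wd, C.lie_skew X Y, ηN]; ring
  have WA : ∀ X Y Z, W (X + Y) Z = W X Z + W Y Z := fun X Y Z => by
    simp only [Wd, C.act_addV, hACMS.η_add, C.act_add, C.lie_add_left]; ring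
  have WS : ∀ (h : F) X Z, W (h • X) Z = h * W X Z := fun h X Z => by
    simp only [Wd, C.act_smulV, hACMS.η_smul, hACMS.η_add, C.act_mul, lSL, ηN]; ring
  have WZ : ∀ Z, W 0 Z = 0 := fun Z => by simpa using WA 0 0 Z
  have WN : ∀ X Z, W (-X) Z = -W X Z := fun X Z => by
    have := WA X (-X) Z
    rw [add_neg_cancel, WZ] at this
    linear_combination -this
  have N0 : ∀ X Y, C.lie (φ X) (φ Y) + φ (φ (C.lie X Y)) - φ (C.lie X (φ Y)) - φ (C.lie (φ X) Y)
      = W X Y • ξ := fun X Y => by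
    have h := hN X Y
    simp only [VFCalc.nij] at h
    rw [← hW, two_mul, add_smul] at h
    exact add_right_cancel h
  have Nη : ∀ X Y, η (C.lie (φ X) (φ Y)) - f * η (C.lie X (φ Y)) - f * η (C.lie (φ X) Y)
      = W X Y := fun X Y => by
    have h := congrArg η (N0 X Y)
    simp only [sub_eq_add_neg, hACMS.η_add, ηN, ηφ, hACMS.η_smul, hACMS.η_ξ] at h
    linear_combination h - η (C.lie X Y) * ff
  have fl : ∀ X Y, f * η (C.lie (φ X) (φ Y)) = - (f * η (C.lie X Y)) := fun X Y => by
    have h := Nη X Y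
    have h2 := Wd X Y
    linear_combination f * h + f * h2 + fa X (η Y) - fa Y (η X)
      + (η (C.lie X (φ Y)) + η (C.lie (φ X) Y)) * ff
  have lf : ∀ Y, C.lie (f • ξ) Y = f • C.lie ξ Y := fun Y => by
    rw [lSL, af]; simp
  have fξ : ∀ Y, f * η (C.lie ξ Y) = 0 := fun Y => by
    have h := fl ξ Y
    rw [φξ, lf, hACMS.η_smul] at h
    linear_combination h - η (C.lie ξ (φ Y)) * ff
  have Wξ : ∀ Y, W ξ Y = 0 := fun Y => by
    have h := Nη ξ Y
    rw [φξ, lf, lf, hACMS.η_smul, hACMS.η_smul] at h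
    linear_combination -h - η (C.lie ξ Y) * ff
  have ηl : ∀ Y, η (C.lie ξ Y) = C.act ξ (η Y) := fun Y => by
    have h := Wd ξ Y
    rw [Wξ, hACMS.η_ξ, a1] at h
    linear_combination h
  -- L_ξ φ = 0
  have comm : ∀ Y, C.lie ξ (φ Y) = φ (C.lie ξ Y) := fun Y => by
    obtain ⟨T, hT⟩ : ∃ T, T = C.lie ξ (φ Y) + -φ (C.lie ξ Y) := ⟨_, rfl⟩
    have h := N0 ξ Y
    rw [φξ, lf, lf, Wξ, hACMS.φ_smul, zero_smul] at h
    have h1 : φ T = f • T := by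
      rw [hT, hACMS.φ_add, φN, smul_add, smul_neg]
      rw [← sub_eq_zero, ← neg_eq_zero, ← h]; abel
    have h2 : φ (φ T) = 0 := by
      rw [h1, hACMS.φ_smul, h1, smul_smul, ff, zero_smul]
    have h3 : η T = 0 := by
      rw [hT, hACMS.η_add, ηN, ηl, ηφ, ηφ, C.act_mul, af, fa, fξ]; ring
    rw [hACMS.φ_sq, h3, zero_smul, add_zero, neg_eq_zero, hT, ← sub_eq_add_neg, sub_eq_zero] at h2
    exact h2
  obtain ⟨K, hK⟩ : ∃ K : V → V → F, ∀ X Y, K X Y =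
    C.act ξ (g X Y) - g (C.lie ξ X) Y - g X (C.lie ξ Y) := ⟨_, fun _ _ => rfl⟩
  have Kinv : ∀ X Y, K (φ X) (φ Y) = K X Y := fun X Y => by
    rw [hK, hK, comm, comm, hACMS.g_compat, hACMS.g_compat, hACMS.g_compat, aS, C.act_mul, ηl, ηl]
    ring
  have Kφ : ∀ X Y, K X (φ Y) = f * η (C.lie X Y) := fun X Y => by
    have h := hd ξ X Y
    simp only [VFCalc.d2, fund] at h
    have e1 : ∀ Y, g ξ (φ Y) = f * η Y := fun Y => by rw [hACMS.g_symm, gξ, ηφ]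
    rw [e1, e1, φξ, gSR, gξ, skew (C.lie ξ Y) X, hACMS.g_symm _ X, C.act_mul, C.act_mul, af, af,
      fa, fa] at h
    rw [hK, comm]
    linear_combination h - 2 * η X * fξ Y
  have fη0 : ∀ X Y, f * η (C.lie X Y) = 0 := fun X Y => by
    apply two_cancel
    linear_combination -Kφ X Y - Kinv X (φ Y) + Kφ (φ X) (φ Y) + fl X Y
  have K0 : ∀ X Y, K X Y = 0 := fun X Y => by
    rw [← Kinv, Kφ, fη0]
  have Wφ : ∀ X Y, W (φ X) (φ Y) = -W X Y := fun X Y => by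
    have h := Nη X Y
    rw [fη0, fη0] at h
    rw [Wd, ηφ, ηφ, C.act_mul, C.act_mul, af, af, fa, fa]
    linear_combination -h
  have Wmid : ∀ X Y, W X (φ Y) = W (φ X) Y := fun X Y => by
    have h := Wφ (φ X) Y
    rw [hACMS.φ_sq, WA, WN, WS, Wξ] at h
    linear_combination -h
  have gSL : ∀ X Y Z, g (X - Y) Z = g X Z - g Y Z := fun X Y Z => by
    rw [sub_eq_add_neg, hACMS.g_add_left, gNL]; ring
  have Dsk : ∀ X Y, g (D X ξ) Y + g (D Y ξ) X = 0 := fun X Y => by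
    have h := K0 X Y
    rw [hK, hLC.metric, ← hLC.torsion_free, ← hLC.torsion_free, gSL, hACMS.g_symm X (_ - _), gSL,
      hACMS.g_symm X (D ξ Y)] at h
    linear_combination h
  have WD : ∀ X Y, W X Y = 2 * g (D X ξ) Y := fun X Y => by
    rw [Wd, ← gξ Y, ← gξ X, ← gξ (C.lie X Y), hLC.metric, hLC.metric, ← hLC.torsion_free, gSL,
      hACMS.g_symm Y, hACMS.g_symm X]
    linear_combination -Dsk X Y
  have Dη : ∀ Y, η (D Y ξ) = 0 := fun Y => by
    apply two_cancel
    have h := hLC.metric Y ξ ξ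
    rw [gξ, hACMS.η_ξ, a1, hACMS.g_symm ξ, gξ] at h
    linear_combination -h
  have hAW : ∀ X Y, 2 * g X (A Y) = -W (φ X) Y := fun X Y => by
    rw [hA, gNR, skew, Dη, Wsk, WD, hACMS.g_symm (φ X)]; ring
  have Wl : ∀ X Y Z, W (C.lie (φ X) (φ Y)) (φ Z) = W (φ (C.lie X Y)) Z
      - W (C.lie X (φ Y)) Z - W (C.lie (φ X) Y) Z := fun X Y Z => by
    have h := congrArg (fun U => W U (φ Z)) (N0 X Y)
    simp only [sub_eq_add_neg, WA, WN, WS, Wξ, Wφ] at h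
    linear_combination h
  have dW : ∀ X Y Z, C.act X (W Y Z) - C.act Y (W X Z) + C.act Z (W X Y)
      - W (C.lie X Y) Z + W (C.lie X Z) Y - W (C.lie Y Z) X = 0 := fun X Y Z => by
    have hJ := congrArg η (C.lie_jacobi X Y Z)
    simp only [Wd, aS, C.act_lie]
    rw [C.lie_skew Z X, C.lie_skew X (C.lie Y Z)] at hJ
    rw [C.lie_skew Y (-C.lie X Z), C.lie_skew Z (C.lie X Y)] at hJ
    simp only [hACMS.η_add, ηN, ηZ] at hJ
    have hn : C.lie (-C.lie X Z) Y = -C.lie (C.lie X Z) Y := by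
      have := lSL (-1) (C.lie X Z) Y
      rw [aN, a1] at this
      simpa using this
    rw [hn, ηN] at hJ
    linear_combination -hJ
  intro X Y Z
  apply two_cancel
  apply two_cancel
  simp only [VFCalc.d2]
  have e : ∀ U X Y, 2 * C.act U (g X (A Y)) = -C.act U (W (φ X) Y) := fun U X Y => by
    rw [← a2, hAW, aN]
  have h1 := dW (φ X) Y Z
  have h2 := dW X (φ Y) Z
  have h3 := dW X Y (φ Z)
  have h4 := dW (φ X) (φ Y) (φ Z)
  simp only [Wl] at h4
  simp only [Wφ, aN] at h4
  simp only [Wmid] at h1 h2 h3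
  linear_combination 2 * e X Y Z - 2 * e Y X Z + 2 * e Z X Y - 2 * hAW (C.lie X Y) Z
    + 2 * hAW (C.lie X Z) Y - 2 * hAW (C.lie Y Z) X - h1 - h2 - h3 - h4
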